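/- Let σ ∈ ℝ, a ∈ ℝ, μ > 0, let ν > 0 be non-integer with m = ⌈ν⌉, and let f : [a,∞) → ℝ be m-times continuously differentiable, with the limits [D_s^{ν−j} f]_{x=a} := lim_{x→a⁺} D_s^{ν−j} f(x) existing for j = 1, …, m. Then for all x > a, I_s^μ[D_s^ν f](x) = D_s^{ν−μ} f(x) − Σ_{j=1}^m [D_s^{ν−j} f]_{x=a} (x−a)^{μ−j} e^{−σ(x−a)} / Γ(μ−j+1), where D_s^{ν−μ} means I_s^{μ−ν} when ν < μ and the identity when ν = μ, and terms whose argument μ−j+1 is a nonpositive integer are interpreted as 0 (via 1/Γ = 0 at the poles of Γ). -/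

import Mathlib

open MeasureTheory Set Filter

/-- The fractional substantial integral of order `ν` with lower terminal `a`
(`I_s^0 f = f`). -/
noncomputable def Isub (σ a ν : ℝ) (f : ℝ → ℝ) : ℝ → ℝ :=
  if ν = 0 then f else
    fun x => (1 / Real.Gamma ν) * ∫ τ in a..x, (x - τ) ^ (ν - 1) * Real.exp (-σ * (x - τ)) * f τ

/-- The substantial derivative operator `D_s f = f′ + σ f`. -/
noncomputable def Dsub (σ : ℝ) (f : ℝ → ℝ) : ℝ → ℝ := fun x => deriv f x + σ * f x

/-- The fractional substantial derivative of order `μ`: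
`D_s^μ f = D_s^m [I_s^{m−μ} f]` with `m = ⌈μ⌉`. -/
noncomputable def Dfrac (σ a μ : ℝ) (f : ℝ → ℝ) : ℝ → ℝ :=
  (Dsub σ)^[⌈μ⌉₊] (Isub σ a ((⌈μ⌉₊ : ℝ) - μ) f)

/-- `D_s^γ` for arbitrary real `γ`: the fractional substantial derivative when `γ > 0`,
the identity when `γ = 0`, and the fractional substantial integral `I_s^{−γ}` when `γ < 0`. -/
noncomputable def DIfrac (σ a γ : ℝ) (f : ℝ → ℝ) : ℝ → ℝ :=
  if 0 < γ then Dfrac σ a γ f else Isub σ a (-γ) f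

/-- Euler's beta integrand on `[0, 1]` is integrable. -/
theorem intervalIntegrable_betaIntegrand {p q : ℝ} (hp : 0 < p) (hq : 0 < q) :
    IntervalIntegrable (fun u : ℝ => (1 - u) ^ (p - 1) * u ^ (q - 1)) volume 0 1 := by
  have h := (Complex.betaIntegral_convergent (u := (q : ℂ)) (v := (p : ℂ))
    (by simpa using hq) (by simpa using hp)).norm
  refine h.congr ?_
  intro u hu
  rw [uIoc_of_le zero_le_one] at hu
  have h1 : (0 : ℝ) ≤ 1 - u := by linarith [hu.2]
  have e1 : ((u : ℂ) ^ ((q : ℂ) - 1)) = ((u ^ (q - 1) : ℝ) : ℂ) := by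
    rw [Complex.ofReal_cpow hu.1.le]; push_cast; rfl
  have e2 : ((1 - (u : ℂ)) ^ ((p : ℂ) - 1)) = (((1 - u) ^ (p - 1) : ℝ) : ℂ) := by
    rw [Complex.ofReal_cpow h1]; push_cast; rfl
  simp only [e1, e2, ← Complex.ofReal_mul, Complex.norm_real]
  rw [Real.norm_of_nonneg (mul_nonneg (Real.rpow_nonneg hu.1.le _) (Real.rpow_nonneg h1 _)),
    mul_comm]

theorem integral_betaIntegrand {p q : ℝ} (hp : 0 < p) (hq : 0 < q) :
    ∫ u in (0 : ℝ)..1, (1 - u) ^ (p - 1) * u ^ (q - 1) = ProbabilityTheory.beta p q := by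
  have hb : ProbabilityTheory.beta p q = ProbabilityTheory.beta q p := by
    simp only [ProbabilityTheory.beta, add_comm, mul_comm]
  rw [hb, ProbabilityTheory.beta_eq_betaIntegralReal _ _ hq hp, Complex.betaIntegral]
  have : ∫ u in (0 : ℝ)..1, (u : ℂ) ^ ((q : ℂ) - 1) * (1 - (u : ℂ)) ^ ((p : ℂ) - 1) =
      ∫ u in (0 : ℝ)..1, (((1 - u) ^ (p - 1) * u ^ (q - 1) : ℝ) : ℂ) := by
    refine intervalIntegral.integral_congr fun u hu => ?_
    rw [uIcc_of_le zero_le_one] at hu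
    have h1 : (0 : ℝ) ≤ 1 - u := by linarith [hu.2]
    simp only [Complex.ofReal_mul, Complex.ofReal_cpow hu.1, Complex.ofReal_cpow h1]
    push_cast
    ring
  rw [this, intervalIntegral.integral_ofReal, Complex.ofReal_re]

theorem betaIntegrand_affine {s x : ℝ} (hsx : s < x) (p q : ℝ) {t : ℝ} (ht : t ∈ Ioc s x) :
    (x - t) ^ (p - 1) * (t - s) ^ (q - 1) = (x - s) ^ (p + q - 2) *
      ((1 - (x - s)⁻¹ * (t - s)) ^ (p - 1) * ((x - s)⁻¹ * (t - s)) ^ (q - 1)) := by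
  have hd : 0 < x - s := sub_pos.2 hsx
  have e1 : 1 - (x - s)⁻¹ * (t - s) = (x - s)⁻¹ * (x - t) := by field_simp; ring
  have h1 : 0 ≤ x - t := sub_nonneg.2 ht.2
  have h2 : 0 ≤ t - s := sub_nonneg.2 ht.1.le
  have hi : 0 ≤ (x - s)⁻¹ := (inv_pos.2 hd).le
  rw [e1, Real.mul_rpow hi h1, Real.mul_rpow hi h2, Real.inv_rpow hd.le, Real.inv_rpow hd.le,
    show p + q - 2 = (p - 1) + (q - 1) by ring, Real.rpow_add hd]
  have := (Real.rpow_pos_of_pos hd (p - 1)).ne'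
  have := (Real.rpow_pos_of_pos hd (q - 1)).ne'
  field_simp

theorem intervalIntegrable_sub_rpow_mul_sub_rpow {p q : ℝ} (hp : 0 < p) (hq : 0 < q) {s x : ℝ}
    (hsx : s ≤ x) :
    IntervalIntegrable (fun t : ℝ => (x - t) ^ (p - 1) * (t - s) ^ (q - 1)) volume s x := by
  rcases hsx.eq_or_lt with rfl | hsx
  · exact IntervalIntegrable.refl
  have hd : x - s ≠ 0 := (sub_pos.2 hsx).ne'
  have h := (((intervalIntegrable_betaIntegrand hp hq).comp_mul_left
    (c := (x - s)⁻¹)).comp_sub_right s).const_mul ((x - s) ^ (p + q - 2))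
  simp only [zero_div, zero_add, one_div, inv_inv, sub_add_cancel] at h
  refine h.congr fun t ht => ?_
  rw [uIoc_of_le hsx.le] at ht
  exact (betaIntegrand_affine hsx p q ht).symm

theorem integral_sub_rpow_mul_sub_rpow {p q : ℝ} (hp : 0 < p) (hq : 0 < q) {s x : ℝ}
    (hsx : s < x) :
    ∫ t in s..x, (x - t) ^ (p - 1) * (t - s) ^ (q - 1) =
      (x - s) ^ (p + q - 1) * ProbabilityTheory.beta p q := by
  have hd : 0 < x - s := sub_pos.2 hsx
  have h1 : ∫ t in s..x, (x - t) ^ (p - 1) * (t - s) ^ (q - 1) =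
      ∫ t in s..x, (x - s) ^ (p + q - 2) *
        ((1 - (x - s)⁻¹ * (t - s)) ^ (p - 1) * ((x - s)⁻¹ * (t - s)) ^ (q - 1)) := by
    refine intervalIntegral.integral_congr_ae (ae_of_all _ fun t ht => ?_)
    rw [uIoc_of_le hsx.le] at ht
    exact betaIntegrand_affine hsx p q ht
  rw [h1, intervalIntegral.integral_const_mul,
    intervalIntegral.integral_comp_sub_right (fun y => (1 - (x - s)⁻¹ * y) ^ (p - 1) *
      ((x - s)⁻¹ * y) ^ (q - 1)) s,
    intervalIntegral.integral_comp_mul_left (fun y => (1 - y) ^ (p - 1) * y ^ (q - 1))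
      (inv_pos.2 hd).ne', sub_self, mul_zero, inv_mul_cancel₀ hd.ne',
    integral_betaIntegrand hp hq, inv_inv, smul_eq_mul, ← mul_assoc,
    show p + q - 1 = (p + q - 2) + 1 by ring, Real.rpow_add_one hd.ne']

/-- The Riemann-Liouville integral of order `α` with lower terminal `a`; order `0` is the
identity. -/
noncomputable def rlIntegral (a α : ℝ) (f : ℝ → ℝ) (x : ℝ) : ℝ :=
  if α = 0 then f x else (1 / Real.Gamma α) * ∫ τ in a..x, (x - τ) ^ (α - 1) * f τ

/-- The power `(x - a) ^ s` normalised by `Γ(s + 1)`. -/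
noncomputable def rlPower (a s x : ℝ) : ℝ := (x - a) ^ s / Real.Gamma (s + 1)

theorem intervalIntegrable_sub_rpow_mul {α : ℝ} (hα : 0 < α) {a x : ℝ} (hax : a ≤ x) {h : ℝ → ℝ}
    (hh : Continuous h) :
    IntervalIntegrable (fun t : ℝ => (x - t) ^ (α - 1) * h t) volume a x := by
  have := intervalIntegrable_sub_rpow_mul_sub_rpow hα one_pos hax
  simp only [sub_self, Real.rpow_zero, mul_one] at this
  exact this.mul_continuousOn hh.continuousOn

theorem rlIntegral_comp {α β : ℝ} (hα : 0 < α) (hβ : 0 < β) {a x : ℝ} (hax : a < x) {h : ℝ → ℝ}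
    (hh : Continuous h) :
    rlIntegral a α (rlIntegral a β h) x = rlIntegral a (α + β) h x := by
  simp only [rlIntegral, hα.ne', hβ.ne', (add_pos hα hβ).ne', if_false]
  set ρ : Measure ℝ := volume.restrict (Ioc a x) with hρ
  set K : ℝ → ℝ → ℝ := fun τ s => {z : ℝ × ℝ | z.2 < z.1}.indicator
    (fun z => (x - z.1) ^ (α - 1) * (z.1 - z.2) ^ (β - 1)) (τ, s) with hK
  have hKτ : ∀ τ s, K τ s = (Iio τ).indicator
      (fun s => (x - τ) ^ (α - 1) * (τ - s) ^ (β - 1)) s := by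
    intro τ s
    simp [hK, indicator_apply]
  have hKs : ∀ τ s, K τ s = (Ioi s).indicator
      (fun τ => (x - τ) ^ (α - 1) * (τ - s) ^ (β - 1)) τ := by
    intro τ s
    simp [hK, indicator_apply]
  have hinter : ∀ s ∈ Ioc a x, Ioc a x ∩ Ioi s = Ioc s x := by
    intro s hs
    ext t
    simp only [mem_inter_iff, mem_Ioc, mem_Ioi]
    constructor
    · rintro ⟨⟨_, h2⟩, h3⟩; exact ⟨h3, h2⟩
    · rintro ⟨h1, h2⟩; exact ⟨⟨hs.1.trans h1, h2⟩, h1⟩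
  have hinter' : ∀ τ ∈ Ioc a x, Ioc a x ∩ Iio τ = Ioo a τ := by
    intro s hs
    ext t
    simp only [mem_inter_iff, mem_Ioc, mem_Iio, mem_Ioo]
    constructor
    · rintro ⟨⟨h1, _⟩, h3⟩; exact ⟨h1, h3⟩
    · rintro ⟨h1, h2⟩; exact ⟨⟨h1, h2.le.trans hs.2⟩, h2⟩
  have hKpos : ∀ s, ∀ τ ∈ Ioc a x, 0 ≤ K τ s := by
    intro s τ hτ
    simp only [hK, indicator_apply, mem_ofPred_eq]
    split_ifs with hlt
    · exact mul_nonneg (Real.rpow_nonneg (sub_nonneg.2 hτ.2) _)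
        (Real.rpow_nonneg (sub_nonneg.2 hlt.le) _)
    · exact le_rfl
  have hint : ∀ s ∈ Ioc a x, Integrable (fun τ => K τ s) ρ := by
    intro s hs
    simp only [hKs]
    rw [integrable_indicator_iff measurableSet_Ioi, IntegrableOn, hρ,
      Measure.restrict_restrict measurableSet_Ioi, inter_comm, hinter s hs]
    exact (intervalIntegrable_iff_integrableOn_Ioc_of_le hs.2).1
      (intervalIntegrable_sub_rpow_mul_sub_rpow hα hβ hs.2)
  have hval : ∀ s ∈ Ioo a x, ∫ τ, K τ s ∂ρ =
      (x - s) ^ (α + β - 1) * ProbabilityTheory.beta α β := by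
    intro s hs
    simp only [hKs]
    rw [hρ, setIntegral_indicator measurableSet_Ioi, hinter s ⟨hs.1, hs.2.le⟩,
      ← intervalIntegral.integral_of_le hs.2.le, integral_sub_rpow_mul_sub_rpow hα hβ hs.2]
  have hae : ∀ᵐ s ∂ρ, s ∈ Ioo a x := by
    rw [hρ, ← restrict_Ioo_eq_restrict_Ioc]
    exact ae_restrict_mem measurableSet_Ioo
  have hmeas : Measurable (Function.uncurry K) := by
    have : Function.uncurry K = {z : ℝ × ℝ | z.2 < z.1}.indicator
      (fun z => (x - z.1) ^ (α - 1) * (z.1 - z.2) ^ (β - 1)) := rfl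
    rw [this]
    refine Measurable.indicator ?_ (measurableSet_lt measurable_snd measurable_fst)
    fun_prop
  have hKint : Integrable (Function.uncurry K) (ρ.prod ρ) := by
    rw [integrable_prod_iff' hmeas.aestronglyMeasurable]
    refine ⟨hae.mono fun s hs => hint s ⟨hs.1, hs.2.le⟩, ?_⟩
    have h2 : Integrable (fun s => (x - s) ^ (α + β - 1) * ProbabilityTheory.beta α β) ρ :=
      (intervalIntegrable_iff_integrableOn_Ioc_of_le hax.le).1
        (intervalIntegrable_sub_rpow_mul (add_pos hα hβ) hax.le continuous_const)
    refine h2.congr (hae.mono fun s hs => ?_)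
    simp only [← hval s hs]
    refine integral_congr_ae ((ae_restrict_mem measurableSet_Ioc).mono fun τ hτ => ?_)
    exact (Real.norm_of_nonneg (hKpos s τ hτ)).symm
  obtain ⟨C, hC⟩ := isCompact_Icc.exists_bound_of_continuousOn (s := Icc a x) hh.continuousOn
  have hKh : Integrable (Function.uncurry fun τ s => K τ s * h s) (ρ.prod ρ) := by
    refine hKint.mul_bdd (c := C) (hh.comp continuous_snd).aestronglyMeasurable ?_
    have : ρ.prod ρ = (volume.prod volume).restrict (Ioc a x ×ˢ Ioc a x) :=
      Measure.prod_restrict _ _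
    rw [this]
    refine (ae_restrict_mem (measurableSet_Ioc.prod measurableSet_Ioc)).mono fun z hz => ?_
    exact hC _ ⟨hz.2.1.le, hz.2.2⟩
  have hswap := integral_integral_swap hKh
  have hL : ∫ τ, ∫ s, K τ s * h s ∂ρ ∂ρ =
      ∫ τ in a..x, (x - τ) ^ (α - 1) * ∫ s in a..τ, (τ - s) ^ (β - 1) * h s := by
    rw [intervalIntegral.integral_of_le hax.le]
    refine setIntegral_congr_fun measurableSet_Ioc fun τ hτ => ?_
    have : ∀ s, K τ s * h s = (Iio τ).indicator
        (fun s => (x - τ) ^ (α - 1) * ((τ - s) ^ (β - 1) * h s)) s := by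
      intro s
      rw [hKτ]
      simp only [indicator_apply]
      split_ifs <;> ring
    simp only [this]
    rw [hρ, setIntegral_indicator measurableSet_Iio, hinter' τ hτ, ← integral_Ioc_eq_integral_Ioo,
      ← intervalIntegral.integral_of_le hτ.1.le, intervalIntegral.integral_const_mul]
  have hR : ∫ s, ∫ τ, K τ s * h s ∂ρ ∂ρ =
      ProbabilityTheory.beta α β * ∫ s in a..x, (x - s) ^ (α + β - 1) * h s := by
    rw [← intervalIntegral.integral_const_mul, intervalIntegral.integral_of_le hax.le]
    refine integral_congr_ae (hae.mono fun s hs => ?_)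
    simp only [integral_mul_const, hval s hs]
    ring
  rw [hL, hR] at hswap
  have hc : ∀ τ, (x - τ) ^ (α - 1) * (1 / Real.Gamma β * ∫ s in a..τ, (τ - s) ^ (β - 1) * h s) =
      1 / Real.Gamma β * ((x - τ) ^ (α - 1) * ∫ s in a..τ, (τ - s) ^ (β - 1) * h s) :=
    fun τ => by ring
  simp only [hc]
  rw [intervalIntegral.integral_const_mul, hswap, ProbabilityTheory.beta]
  have := (Real.Gamma_pos_of_pos hα).ne'
  have := (Real.Gamma_pos_of_pos hβ).ne'
  field_simp

theorem rlIntegral_zero (a : ℝ) (f : ℝ → ℝ) : rlIntegral a 0 f = f := by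
  ext x
  simp [rlIntegral]

theorem rlIntegral_of_ne {α : ℝ} (hα : α ≠ 0) (a : ℝ) (f : ℝ → ℝ) (x : ℝ) :
    rlIntegral a α f x = (1 / Real.Gamma α) * ∫ τ in a..x, (x - τ) ^ (α - 1) * f τ := by
  simp [rlIntegral, hα]

theorem rlIntegral_congr {a x α : ℝ} (hx : a < x) {f g : ℝ → ℝ} (hfg : EqOn f g (Ioi a)) :
    rlIntegral a α f x = rlIntegral a α g x := by
  unfold rlIntegral
  split_ifs with h
  · exact hfg hx
  · congr 1
    refine intervalIntegral.integral_congr_ae (ae_of_all _ fun t ht => ?_)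
    rw [uIoc_of_le hx.le] at ht
    rw [hfg ht.1]

theorem rlIntegral_rlIntegral {α β : ℝ} (hα : 0 ≤ α) (hβ : 0 ≤ β) {a x : ℝ} (hax : a < x)
    {h : ℝ → ℝ} (hh : Continuous h) :
    rlIntegral a α (rlIntegral a β h) x = rlIntegral a (α + β) h x := by
  rcases hα.eq_or_lt with rfl | hα
  · rw [rlIntegral_zero, zero_add]
  rcases hβ.eq_or_lt with rfl | hβ
  · rw [rlIntegral_zero, add_zero]
  exact rlIntegral_comp hα hβ hax hh

/-- On `[a, ∞)` a Riemann-Liouville integral of positive order of a continuous function agrees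
with a continuous function vanishing at `a`. -/
theorem exists_continuous_eqOn_rlIntegral {β : ℝ} (hβ : 0 < β) (a : ℝ) {h : ℝ → ℝ}
    (hh : Continuous h) :
    ∃ Φ : ℝ → ℝ, Continuous Φ ∧ Φ a = 0 ∧ EqOn (rlIntegral a β h) Φ (Ici a) := by
  refine ⟨fun x => (1 / Real.Gamma β) * ((x - a) ^ β *
    ∫ u in (0 : ℝ)..1, (1 - u) ^ (β - 1) * h (a + (x - a) * u)), ?_, ?_, ?_⟩
  · refine continuous_const.mul (((continuous_id.sub continuous_const).rpow_const
      fun _ => Or.inr hβ.le).mul ?_)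
    refine continuous_iff_continuousAt.2 fun x₀ => ?_
    obtain ⟨C, hC⟩ := (isCompact_Icc.prod isCompact_Icc).exists_bound_of_continuousOn
      (s := Icc (x₀ - 1) (x₀ + 1) ×ˢ Icc (0 : ℝ) 1) (f := fun z : ℝ × ℝ => h (a + (z.1 - a) * z.2))
      (by fun_prop)
    have hi : IntervalIntegrable (fun u : ℝ => (1 - u) ^ (β - 1) * C) volume 0 1 :=
      intervalIntegrable_sub_rpow_mul hβ zero_le_one continuous_const
    refine intervalIntegral.continuousAt_of_dominated_interval
      (bound := fun u => (1 - u) ^ (β - 1) * C) ?_ ?_ hi ?_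
    · refine Eventually.of_forall fun x => Measurable.aestronglyMeasurable ?_
      have : Measurable fun u => h (a + (x - a) * u) := hh.measurable.comp (by fun_prop)
      fun_prop
    · filter_upwards [Icc_mem_nhds (sub_one_lt x₀) (lt_add_one x₀)] with x hx
      refine ae_of_all _ fun u hu => ?_
      rw [uIoc_of_le zero_le_one] at hu
      have h1 := Real.rpow_nonneg (sub_nonneg.2 hu.2) (β - 1)
      rw [norm_mul, Real.norm_of_nonneg h1]
      exact mul_le_mul_of_nonneg_left (hC (x, u) ⟨hx, hu.1.le, hu.2⟩) h1
    · exact ae_of_all _ fun u _ => by fun_prop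
  · simp [Real.zero_rpow hβ.ne']
  · intro x hx
    rcases (mem_Ici.1 hx).eq_or_lt with rfl | hx
    · simp [rlIntegral, hβ.ne', Real.zero_rpow hβ.ne']
    have hd : 0 < x - a := sub_pos.2 hx
    rw [rlIntegral_of_ne hβ.ne']
    simp only
    congr 1
    have := intervalIntegral.smul_integral_comp_add_mul
      (fun τ : ℝ => (x - τ) ^ (β - 1) * h τ) (a := 0) (b := 1) (x - a) a
    rw [mul_zero, add_zero, mul_one, add_sub_cancel] at this
    have hp : (x - a) ^ β = (x - a) * (x - a) ^ (β - 1) := by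
      rw [mul_comm, ← Real.rpow_add_one hd.ne', sub_add_cancel]
    rw [← this, smul_eq_mul, hp, mul_assoc]
    congr 1
    rw [← intervalIntegral.integral_const_mul]
    refine intervalIntegral.integral_congr fun u hu => ?_
    rw [uIcc_of_le zero_le_one] at hu
    rw [show x - (a + (x - a) * u) = (x - a) * (1 - u) by ring,
      Real.mul_rpow hd.le (sub_nonneg.2 hu.2), mul_assoc]

theorem tendsto_rlIntegral_nhdsGT {β : ℝ} (hβ : 0 < β) (a : ℝ) {h : ℝ → ℝ} (hh : Continuous h) :
    Tendsto (rlIntegral a β h) (nhdsWithin a (Ioi a)) (nhds 0) := by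
  obtain ⟨Φ, hc, h0, he⟩ := exists_continuous_eqOn_rlIntegral hβ a hh
  rw [← h0]
  refine (hc.continuousWithinAt (s := Ioi a) (x := a)).tendsto.congr' ?_
  filter_upwards [self_mem_nhdsWithin] with x hx
  exact (he (mem_Ici.2 (le_of_lt hx))).symm

theorem rlIntegral_one (a : ℝ) (f : ℝ → ℝ) (x : ℝ) : rlIntegral a 1 f x = ∫ τ in a..x, f τ := by
  simp [rlIntegral]

theorem hasDerivAt_rlIntegral {β : ℝ} (hβ : 1 ≤ β) {a x : ℝ} (hx : a < x) {h : ℝ → ℝ}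
    (hh : Continuous h) :
    HasDerivAt (rlIntegral a β h) (rlIntegral a (β - 1) h x) x := by
  obtain ⟨Φ, hc, he⟩ : ∃ Φ : ℝ → ℝ, Continuous Φ ∧ EqOn (rlIntegral a (β - 1) h) Φ (Ici a) := by
    rcases hβ.eq_or_lt with rfl | hβ
    · exact ⟨h, hh, by simp [rlIntegral_zero, EqOn]⟩
    · obtain ⟨Φ, h1, -, h2⟩ := exists_continuous_eqOn_rlIntegral (sub_pos.2 hβ) a hh
      exact ⟨Φ, h1, h2⟩
  have hd : HasDerivAt (fun y => ∫ τ in a..y, Φ τ) (Φ x) x :=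
    intervalIntegral.integral_hasDerivAt_right (hc.intervalIntegrable _ _)
      hc.stronglyMeasurable.stronglyMeasurableAtFilter hc.continuousAt
  rw [he hx.le]
  refine hd.congr_of_eventuallyEq ?_
  filter_upwards [Ioi_mem_nhds hx] with y hy
  have h1 := rlIntegral_rlIntegral zero_le_one (sub_nonneg.2 hβ) hy hh
  rw [add_sub_cancel] at h1
  rw [← h1, ← rlIntegral_one]
  exact rlIntegral_congr hy (he.mono Ioi_subset_Ici_self)

theorem intervalIntegrable_sub_rpow_mul_rlPower {α s : ℝ} (hα : 0 < α) (hs : -1 < s) {a x : ℝ}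
    (hx : a ≤ x) :
    IntervalIntegrable (fun t => (x - t) ^ (α - 1) * rlPower a s t) volume a x := by
  have h := (intervalIntegrable_sub_rpow_mul_sub_rpow hα (neg_lt_iff_pos_add.1 hs) hx).mul_const
    (Real.Gamma (s + 1))⁻¹
  simpa only [add_sub_cancel_right, rlPower, div_eq_mul_inv, mul_assoc] using h

theorem rlIntegral_rlPower {α s : ℝ} (hα : 0 ≤ α) (hs : -1 < s) {a x : ℝ} (hx : a < x) :
    rlIntegral a α (rlPower a s) x = rlPower a (α + s) x := by
  rcases hα.eq_or_lt with rfl | hα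
  · rw [rlIntegral_zero, zero_add]
  have hs' : 0 < s + 1 := neg_lt_iff_pos_add.1 hs
  have h := integral_sub_rpow_mul_sub_rpow hα hs' hx
  rw [add_sub_cancel_right] at h
  rw [rlIntegral_of_ne hα.ne']
  simp only [rlPower, ← mul_div_assoc]
  rw [intervalIntegral.integral_div, h, ProbabilityTheory.beta,
    show α + (s + 1) - 1 = α + s by ring, ← add_assoc]
  have := (Real.Gamma_pos_of_pos hα).ne'
  have := (Real.Gamma_pos_of_pos hs').ne'
  field_simp

theorem hasDerivAt_rlPower (s : ℝ) {a x : ℝ} (hx : a < x) :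
    HasDerivAt (rlPower a s) (rlPower a (s - 1) x) x := by
  rcases eq_or_ne s 0 with rfl | hs
  · have : rlPower a 0 = fun _ => 1 := by ext y; simp [rlPower]
    rw [this]
    simpa [rlPower, Real.Gamma_zero] using hasDerivAt_const x (1 : ℝ)
  · have h := ((((hasDerivAt_id x).sub_const a).rpow_const (p := s)
      (Or.inl (sub_pos.2 hx).ne')).div_const (Real.Gamma (s + 1)))
    convert! h using 1
    rw [rlPower, Real.Gamma_add_one hs, sub_add_cancel, id, one_mul, mul_div_mul_left _ _ hs]

theorem tendsto_rlPower_nhdsGT {s : ℝ} (hs : 0 < s) (a : ℝ) :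
    Tendsto (rlPower a s) (nhdsWithin a (Ioi a)) (nhds 0) := by
  have hc : Continuous (rlPower a s) :=
    ((continuous_id.sub continuous_const).rpow_const fun _ => Or.inr hs.le).div_const _
  have h0 : rlPower a s a = 0 := by simp [rlPower, Real.zero_rpow hs.ne']
  rw [← h0]
  exact hc.continuousWithinAt.tendsto

/-- The order-`γ` fractional derivative of the Taylor expansion with coefficients `c` and
remainder `h` of order `n`. -/
noncomputable def rlExpansion (a : ℝ) (n : ℕ) (c : ℕ → ℝ) (h : ℝ → ℝ) (γ x : ℝ) : ℝ :=
  ∑ k ∈ Finset.range n, c k * rlPower a (k - γ) x + rlIntegral a (n - γ) h x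

theorem rlIntegral_rlExpansion {a : ℝ} {n : ℕ} {c : ℕ → ℝ} {h : ℝ → ℝ} (hh : Continuous h)
    {α γ : ℝ} (hα : 0 ≤ α) (hγ : γ ≤ n) (hc : ∀ k < n, c k = 0 ∨ -1 < k - γ) {x : ℝ} (hx : a < x) :
    rlIntegral a α (rlExpansion a n c h γ) x = rlExpansion a n c h (γ - α) x := by
  rcases hα.eq_or_lt with rfl | hα
  · rw [rlIntegral_zero, sub_zero]
  have hi1 : ∀ k ∈ Finset.range n, IntervalIntegrable
      (fun t => (x - t) ^ (α - 1) * (c k * rlPower a (k - γ) t)) volume a x := by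
    intro k hk
    rcases hc k (Finset.mem_range.1 hk) with h0 | h0
    · simp [h0]
    · simpa only [mul_left_comm] using
        (intervalIntegrable_sub_rpow_mul_rlPower hα h0 hx.le).const_mul (c k)
  have hi2 : IntervalIntegrable
      (fun t => (x - t) ^ (α - 1) * rlIntegral a (n - γ) h t) volume a x := by
    rcases hγ.eq_or_lt with h0 | h0
    · rw [h0, sub_self, rlIntegral_zero]
      exact intervalIntegrable_sub_rpow_mul hα hx.le hh
    · obtain ⟨Φ, h1, -, h2⟩ := exists_continuous_eqOn_rlIntegral (sub_pos.2 h0) a hh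
      refine (intervalIntegrable_sub_rpow_mul hα hx.le h1).congr fun t ht => ?_
      rw [uIoc_of_le hx.le] at ht
      simp only [h2 (le_of_lt ht.1)]
  have hsum := rlIntegral_rlIntegral hα.le (sub_nonneg.2 hγ) hx hh
  have hpow : ∀ k ∈ Finset.range n, 1 / Real.Gamma α *
      ∫ t in a..x, (x - t) ^ (α - 1) * (c k * rlPower a (k - γ) t) =
      c k * rlPower a (k - (γ - α)) x := by
    intro k hk
    rcases hc k (Finset.mem_range.1 hk) with h0 | h0
    · simp [h0]
    · have := rlIntegral_rlPower hα.le h0 hx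
      rw [rlIntegral_of_ne hα.ne'] at this
      simp only [mul_left_comm _ (c k), intervalIntegral.integral_const_mul]
      rw [this]
      congr 2
      ring
  rw [rlIntegral_of_ne hα.ne'] at hsum ⊢
  simp only [rlExpansion, mul_add, Finset.mul_sum]
  have hi : IntervalIntegrable (fun t => ∑ k ∈ Finset.range n,
      (x - t) ^ (α - 1) * (c k * rlPower a (k - γ) t)) volume a x := by
    simpa only [Finset.sum_fn] using IntervalIntegrable.sum _ hi1
  rw [intervalIntegral.integral_add hi hi2,
    intervalIntegral.integral_finsetSum hi1, mul_add, hsum, Finset.mul_sum,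
    Finset.sum_congr rfl hpow]
  congr 2
  ring

theorem hasDerivAt_rlExpansion {a : ℝ} {n : ℕ} (c : ℕ → ℝ) {h : ℝ → ℝ} (hh : Continuous h)
    {γ : ℝ} (hγ : γ + 1 ≤ n) {x : ℝ} (hx : a < x) :
    HasDerivAt (rlExpansion a n c h γ) (rlExpansion a n c h (γ + 1) x) x := by
  have h1 := HasDerivAt.fun_sum (u := Finset.range n) fun k _ =>
    (hasDerivAt_rlPower ((k : ℝ) - γ) hx).const_mul (c k)
  have h2 := hasDerivAt_rlIntegral (a := a) (x := x) (β := n - γ) (by linarith) hx hh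
  simp only [sub_sub] at h1 h2
  exact h1.add h2

theorem exists_eqOn_rlExpansion (a : ℝ) (n : ℕ) (g : ℝ → ℝ) (hg : ContDiffOn ℝ n g (Ici a)) :
    ∃ (c : ℕ → ℝ) (h : ℝ → ℝ), Continuous h ∧ EqOn g (rlExpansion a n c h 0) (Ioi a) := by
  induction n generalizing g with
  | zero =>
    refine ⟨0, fun x => g (max a x), ?_, fun x hx => ?_⟩
    · exact hg.continuousOn.comp_continuous (by fun_prop) fun x => le_max_left a x
    · simp [rlExpansion, rlIntegral_zero, max_eq_right (le_of_lt (mem_Ioi.1 hx))]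
  | succ n ih =>
    have hg' := (contDiffOn_succ_iff_derivWithin (n := n) (uniqueDiffOn_Ici a)).1
      (by exact_mod_cast hg)
    obtain ⟨c, h, hh, he⟩ := ih _ hg'.2.2
    refine ⟨fun k => Nat.casesOn k (g a) c, h, hh, fun x hx => ?_⟩
    have hx' : a < x := hx
    have hcont : ContinuousOn (derivWithin g (Ici a)) (uIcc a x) :=
      hg'.2.2.continuousOn.mono (by rw [uIcc_of_le hx'.le]; exact Icc_subset_Ici_self)
    have hftc := intervalIntegral.integral_eq_sub_of_hasDerivAt_of_le hx'.le
      (f := g) (f' := derivWithin g (Ici a)) (hg.continuousOn.mono Icc_subset_Ici_self)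
      (fun t ht => ((hg'.1 t ht.1.le).hasDerivWithinAt).hasDerivAt (Ici_mem_nhds ht.1))
      hcont.intervalIntegrable
    have h1 := rlIntegral_rlExpansion (a := a) (n := n) (c := c) hh zero_le_one (Nat.cast_nonneg n)
      (fun k _ => Or.inr (by rw [sub_zero]; linarith [Nat.cast_nonneg (α := ℝ) k])) hx'
    rw [← rlIntegral_congr hx' he, rlIntegral_one, hftc] at h1
    rw [rlExpansion, Finset.sum_range_succ']
    have h0 : rlPower a 0 x = 1 := by simp [rlPower]
    simp only [rlExpansion, zero_sub, sub_neg_eq_add] at h1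
    simp only [Nat.cast_add, Nat.cast_one, sub_zero, Nat.cast_zero, h0]
    rw [add_right_comm, ← h1, mul_one]
    exact (sub_add_cancel _ _).symm

theorem tendsto_rlExpansion_nhdsGT {a : ℝ} {n : ℕ} {c : ℕ → ℝ} {h : ℝ → ℝ} (hh : Continuous h)
    {γ : ℝ} (hγ : γ < n) (s : Finset ℕ) (hc : ∀ k ∈ s, c k = 0 ∨ 0 < k - γ) :
    Tendsto (fun x => ∑ k ∈ s, c k * rlPower a (k - γ) x + rlIntegral a (n - γ) h x)
      (nhdsWithin a (Ioi a)) (nhds 0) := by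
  have h1 : Tendsto (fun x => ∑ k ∈ s, c k * rlPower a (k - γ) x)
      (nhdsWithin a (Ioi a)) (nhds (∑ k ∈ s, 0)) := by
    refine tendsto_finsetSum _ fun k hk => ?_
    rcases hc k hk with h0 | h0
    · simp [h0]
    · simpa using (tendsto_rlPower_nhdsGT h0 a).const_mul (c k)
  simpa using h1.add (tendsto_rlIntegral_nhdsGT (sub_pos.2 hγ) a hh)

theorem eq_zero_of_tendsto_mul_rlPower {a s b l : ℝ} (hs : s < 0) (hs1 : -1 < s)
    (h : Tendsto (fun x => b * rlPower a s x) (nhdsWithin a (Ioi a)) (nhds l)) : b = 0 := by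
  have hp : Tendsto (fun x : ℝ => (x - a) ^ (-s)) (nhdsWithin a (Ioi a)) (nhds 0) := by
    have hc : Continuous fun x : ℝ => (x - a) ^ (-s) :=
      (continuous_id.sub continuous_const).rpow_const fun _ => Or.inr (neg_pos.2 hs).le
    simpa [Real.zero_rpow (neg_ne_zero.2 hs.ne)] using
      (hc.continuousWithinAt (s := Ioi a) (x := a)).tendsto
  have hG : Real.Gamma (s + 1) ≠ 0 := (Real.Gamma_pos_of_pos (neg_lt_iff_pos_add.1 hs1)).ne'
  have h1 := h.mul hp
  rw [mul_zero] at h1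
  have h2 : Tendsto (fun _ : ℝ => b / Real.Gamma (s + 1)) (nhdsWithin a (Ioi a)) (nhds 0) := by
    refine h1.congr' ?_
    filter_upwards [self_mem_nhdsWithin] with x hx
    have hx' : 0 < x - a := sub_pos.2 hx
    have := (Real.rpow_pos_of_pos hx' s).ne'
    rw [rlPower, Real.rpow_neg hx'.le]
    field_simp
  have h3 := tendsto_nhds_unique h2 tendsto_const_nhds
  exact (div_eq_zero_iff.1 h3.symm).resolve_right hG

theorem Isub_eqOn_exp_mul_rlIntegral {σ a : ℝ} {f g : ℝ → ℝ}
    (hfg : EqOn f (fun x => Real.exp (-σ * (x - a)) * g x) (Ioi a)) (α : ℝ) :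
    EqOn (Isub σ a α f) (fun x => Real.exp (-σ * (x - a)) * rlIntegral a α g x) (Ioi a) := by
  intro x hx
  rcases eq_or_ne α 0 with rfl | hα
  · simpa [Isub, rlIntegral_zero] using hfg hx
  · simp only [Isub, hα, if_false, rlIntegral_of_ne hα]
    rw [mul_left_comm]
    congr 1
    rw [← intervalIntegral.integral_const_mul]
    refine intervalIntegral.integral_congr_ae (ae_of_all _ fun t ht => ?_)
    rw [uIoc_of_le (le_of_lt hx)] at ht
    rw [hfg ht.1, show -σ * (x - a) = -σ * (x - t) + -σ * (t - a) by ring, Real.exp_add]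
    ring

theorem Dsub_eqOn_exp_mul {σ a : ℝ} {F G G' : ℝ → ℝ}
    (hF : EqOn F (fun x => Real.exp (-σ * (x - a)) * G x) (Ioi a))
    (hG : ∀ x ∈ Ioi a, HasDerivAt G (G' x) x) :
    EqOn (Dsub σ F) (fun x => Real.exp (-σ * (x - a)) * G' x) (Ioi a) := by
  intro x hx
  have he : HasDerivAt (fun x => Real.exp (-σ * (x - a)))
      (Real.exp (-σ * (x - a)) * (-σ * 1)) x :=
    (((hasDerivAt_id x).sub_const a).const_mul (-σ)).exp
  have hd := (he.mul (hG x hx)).congr_of_eventuallyEq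
    (hF.eventuallyEq_of_mem (Ioi_mem_nhds hx))
  simp only [Dsub, hd.deriv, hF hx]
  ring

theorem iterate_Dsub_eqOn_exp_mul_rlExpansion {σ a : ℝ} {n : ℕ} {c : ℕ → ℝ} {h : ℝ → ℝ}
    (hh : Continuous h) {F : ℝ → ℝ} {δ : ℝ}
    (hF : EqOn F (fun x => Real.exp (-σ * (x - a)) * rlExpansion a n c h δ x) (Ioi a))
    (j : ℕ) (hj : δ + j ≤ n) :
    EqOn ((Dsub σ)^[j] F)
      (fun x => Real.exp (-σ * (x - a)) * rlExpansion a n c h (δ + j) x) (Ioi a) := by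
  induction j with
  | zero => simpa using hF
  | succ j ih =>
    push_cast at hj ⊢
    rw [Function.iterate_succ_apply', ← add_assoc]
    exact Dsub_eqOn_exp_mul (ih (by linarith)) fun x hx =>
      hasDerivAt_rlExpansion c hh (by linarith) hx

theorem DIfrac_eqOn_exp_mul_rlExpansion {σ a : ℝ} {n : ℕ} {c : ℕ → ℝ} {h : ℝ → ℝ}
    (hh : Continuous h) {f : ℝ → ℝ}
    (hf : EqOn f (fun x => Real.exp (-σ * (x - a)) * rlExpansion a n c h 0 x) (Ioi a))
    {γ : ℝ} (hγ : γ ≤ n) :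
    EqOn (DIfrac σ a γ f)
      (fun x => Real.exp (-σ * (x - a)) * rlExpansion a n c h γ x) (Ioi a) := by
  have hI : ∀ α, 0 ≤ α → EqOn (Isub σ a α f)
      (fun x => Real.exp (-σ * (x - a)) * rlExpansion a n c h (-α) x) (Ioi a) := by
    intro α hα x hx
    rw [Isub_eqOn_exp_mul_rlIntegral hf α hx]
    simp only
    rw [rlIntegral_rlExpansion hh hα (Nat.cast_nonneg n)
      (fun k _ => Or.inr (by rw [sub_zero]; linarith [Nat.cast_nonneg (α := ℝ) k])) hx, zero_sub]
  by_cases hpos : 0 < γ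
  · have h1 := iterate_Dsub_eqOn_exp_mul_rlExpansion hh
      (hI (⌈γ⌉₊ - γ) (sub_nonneg.2 (Nat.le_ceil γ))) ⌈γ⌉₊ (by linarith)
    simpa [DIfrac, Dfrac, hpos] using h1
  · simpa [DIfrac, hpos] using hI (-γ) (by linarith)

theorem rlExpansion_coeff_eq_zero {a : ℝ} {n : ℕ} {c : ℕ → ℝ} {h : ℝ → ℝ} (hh : Continuous h)
    {ν : ℝ} (hn : ν < n) (hn1 : (n : ℝ) - 1 < ν) (L : ℕ → ℝ)
    (hL : ∀ j ∈ Finset.Icc 1 n,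
      Tendsto (rlExpansion a n c h (ν - j)) (nhdsWithin a (Ioi a)) (nhds (L j)))
    (k : ℕ) (hk : k + 1 < n) : c k = 0 := by
  induction k using Nat.strong_induction_on with
  | _ k ih =>
    obtain ⟨j, rfl⟩ : ∃ j, n = k + 1 + j := ⟨n - (k + 1), by omega⟩
    push_cast at hn hn1
    have h1 := hL j (Finset.mem_Icc.2 ⟨by omega, by omega⟩)
    have h2 := tendsto_rlExpansion_nhdsGT (a := a) (n := k + 1 + j) (c := c) hh (γ := ν - j)
      (by push_cast; linarith [Nat.cast_nonneg (α := ℝ) j])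
      ((Finset.range (k + 1 + j)).erase k) (by
        intro i hi
        rw [Finset.mem_erase, Finset.mem_range] at hi
        rcases lt_or_gt_of_ne hi.1 with hlt | hgt
        · exact Or.inl (ih i hlt (by omega))
        · have : (k : ℝ) + 1 ≤ i := by exact_mod_cast hgt
          exact Or.inr (by linarith))
    refine eq_zero_of_tendsto_mul_rlPower (a := a) (s := k - (ν - j)) (by linarith) (by linarith)
      ((h1.sub h2).congr fun x => ?_)
    rw [rlExpansion, ← Finset.add_sum_erase _ _ (Finset.mem_range.2 (by omega : k < k + 1 + j))]
    ring

/-- Lemma 2.9: `D_s^{−μ}[D_s^ν f](x) = D_s^{ν−μ} f(x) − Σ_{j=1}^m [D_s^{ν−j} f]_{x=a}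
(x−a)^{μ−j} e^{−σ(x−a)} / Γ(μ−j+1)` (terms with `μ−j+1` a nonpositive integer vanish
since `1/Γ = 0` at the poles of `Γ`). -/
theorem substantial_integral_of_substantial_derivative_general
    (σ a μ ν : ℝ) (hμ : 0 < μ) (hν : 0 < ν) (hni : ∀ n : ℤ, ν ≠ (n : ℝ)) (f : ℝ → ℝ)
    (hf : ContDiffOn ℝ ((⌈ν⌉₊ : ℕ) : ℕ∞) f (Set.Ici a))
    (L : ℕ → ℝ)
    (hL : ∀ j ∈ Finset.Icc 1 ⌈ν⌉₊,
      Tendsto (DIfrac σ a (ν - (j : ℝ)) f) (nhdsWithin a (Set.Ioi a)) (nhds (L j))) :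
    ∀ x > a, Isub σ a μ (Dfrac σ a ν f) x = DIfrac σ a (ν - μ) f x -
      ∑ j ∈ Finset.Icc 1 ⌈ν⌉₊, L j * (x - a) ^ (μ - (j : ℝ)) *
        Real.exp (-σ * (x - a)) / Real.Gamma (μ - (j : ℝ) + 1) := by
  intro x hx
  set n := ⌈ν⌉₊ with hn_def
  have hn : ν < n := lt_of_le_of_ne (Nat.le_ceil ν) (by exact_mod_cast hni n)
  have hn1 : (n : ℝ) - 1 < ν := by linarith [Nat.ceil_lt_add_one hν.le]
  have hexp : ∀ y, Real.exp (-σ * (y - a)) * Real.exp (σ * (y - a)) = 1 := by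
    intro y
    rw [← Real.exp_add]
    simp
  obtain ⟨c, h, hh, hg⟩ := exists_eqOn_rlExpansion a n (fun y => Real.exp (σ * (y - a)) * f y)
    (ContDiffOn.mul (ContDiff.contDiffOn (by fun_prop)) (by exact_mod_cast hf))
  have hfE : EqOn f (fun y => Real.exp (-σ * (y - a)) * rlExpansion a n c h 0 y) (Ioi a) := by
    intro y hy
    simp only [← hg hy]
    rw [← mul_assoc, hexp, one_mul]
  have hL' : ∀ j ∈ Finset.Icc 1 n, Tendsto (rlExpansion a n c h (ν - j))
      (nhdsWithin a (Ioi a)) (nhds (L j)) := by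
    intro j hj
    have he : Tendsto (fun y => Real.exp (σ * (y - a))) (nhdsWithin a (Ioi a)) (nhds 1) := by
      have hc : Continuous fun y => Real.exp (σ * (y - a)) := by fun_prop
      simpa using (hc.continuousWithinAt (s := Ioi a) (x := a)).tendsto
    have h1 := he.mul (hL j hj)
    rw [one_mul] at h1
    refine h1.congr' ?_
    filter_upwards [self_mem_nhdsWithin] with y hy
    rw [DIfrac_eqOn_exp_mul_rlExpansion hh hfE
      (by linarith [Nat.cast_nonneg (α := ℝ) j] : ν - j ≤ n) hy]
    simp only
    rw [← mul_assoc, mul_comm (Real.exp _), hexp, one_mul]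
  have hc : ∀ k < n, c k = 0 ∨ (n : ℝ) - 1 - ν ≤ k - ν := by
    intro k hk
    rcases (Nat.succ_le_of_lt hk).lt_or_eq with hlt | heq
    · exact Or.inl (rlExpansion_coeff_eq_zero hh hn hn1 L hL' k hlt)
    · refine Or.inr ?_
      rw [← heq]
      push_cast
      linarith
  have hL0 : ∀ j ∈ Finset.Icc 1 n, L j = 0 := by
    intro j hj
    have hj1 : (1 : ℝ) ≤ j := by exact_mod_cast (Finset.mem_Icc.1 hj).1
    refine tendsto_nhds_unique (hL' j hj)
      (tendsto_rlExpansion_nhdsGT hh (by linarith) (Finset.range n) fun k hk => ?_)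
    exact (hc k (Finset.mem_range.1 hk)).imp_right fun h1 => by linarith
  have hD := DIfrac_eqOn_exp_mul_rlExpansion hh hfE hn.le
  rw [DIfrac, if_pos hν] at hD
  rw [Finset.sum_eq_zero fun j hj => by rw [hL0 j hj]; simp, sub_zero,
    Isub_eqOn_exp_mul_rlIntegral hD μ hx,
    DIfrac_eqOn_exp_mul_rlExpansion hh hfE (by linarith : ν - μ ≤ n) hx]
  simp only
  rw [rlIntegral_rlExpansion hh hμ.le hn.le
    (fun k hk => (hc k hk).imp_right fun h1 => by linarith) hx]
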